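/- Theorem 4 (Closed-loop incremental ℓ₂-gain of the realized controller): Let 𝒳 ⊆ ℝ^{n_x} be convex, let f : ℝ^{n_x} → ℝ^{n_x} and h_z : ℝ^{n_x} → ℝ^{n_z} be C¹, and consider the generalized plant x_{k+1} = f(x_k) + B_w w_k + B_u u_k, z_k = h_z(x_k) + D_zw w_k + D_zu u_k, y_k = C_y x_k + D_yw w_k with constant matrices B_w, B_u, D_zw, D_zu, C_y, D_yw. Let 𝒫 ⊆ ℝ^{n_ρ}, let ψ : 𝒳 → 𝒫 be continuous, and let A : 𝒫 → ℝ^{n_x×n_x}, C_z : 𝒫 → ℝ^{n_z×n_x} be continuous with A(ψ(x)) = (∂f/∂x)(x) and C_z(ψ(x)) = (∂h_z/∂x)(x) for all x ∈ 𝒳 (LPV embedding of the differential form). Let A_{δc}, B_{δc}, C_{δc}, D_{δc} : 𝒫 → matrices be continuous controller functions, and define the closed-loop differential matrices 𝒜_cl(ρ) = [[A(ρ) + B_u D_{δc}(ρ) C_y, B_u C_{δc}(ρ)], [B_{δc}(ρ) C_y, A_{δc}(ρ)]], ℬ_cl(ρ) = [[B_w + B_u D_{δc}(ρ) D_yw],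 [B_{δc}(ρ) D_yw]], 𝒞_cl(ρ) = [C_z(ρ) + D_zu D_{δc}(ρ) C_y, D_zu C_{δc}(ρ)], 𝒟_cl(ρ) = D_zw + D_zu D_{δc}(ρ) D_yw. Assume there exist γ > 0 and a symmetric positive definite Q ∈ ℝ^{(n_x+n_{x_c})×(n_x+n_{x_c})} such that for all ρ ∈ 𝒫 and all δχ, δw: (𝒜_cl(ρ) δχ + ℬ_cl(ρ) δw)ᵀ Q (𝒜_cl(ρ) δχ + ℬ_cl(ρ) δw) − δχᵀ Q δχ ≤ γ ‖δw‖² − γ⁻¹ ‖𝒞_cl(ρ) δχ + 𝒟_cl(ρ) δw‖². Let (x*, w*, u*, z*, y*) be a trajectory of the plant with x*_k ∈ 𝒳, and let (x, w, u, z, y) be a trajectory of the closed loop of the plant with the realized primal controller, i.e., u_{c,k} = y_k, u*_{c,k} = y*_k, y*_{c,k} = u*_k, u_k = y_{c,k}, where Δx_{c,k+1} = (∫₀¹ A_{δc}(ρ̄_k(λ)) dλ) Δx_{c,k} + (∫₀¹ B_{δc}(ρ̄_k(λ)) dλ)(u_{c,k} − u*_{c,k}) and y_{c,k} = y*_{c,k}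 + (∫₀¹ C_{δc}(ρ̄_k(λ)) dλ) Δx_{c,k} + (∫₀¹ D_{δc}(ρ̄_k(λ)) dλ)(u_{c,k} − u*_{c,k}) with ρ̄_k(λ) = ψ(x*_k + λ(x_k − x*_k)), and with x_k ∈ 𝒳 for all k. If w − w* is square-summable, then z − z* is square-summable and ‖z − z*‖₂ ≤ γ ‖w − w*‖₂ + sqrt(γ · θ₀ᵀ Q θ₀), where θ₀ = (x₀ − x₀*, Δx_{c,0}). -/

import Mathlib

open Matrix Set

/-- `F : ℝ → ι → ℝ` is coordinatewise integrable over `[0, 1]`, with average `m`. -/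
def HasAverage {ι : Type*} (F : ℝ → ι → ℝ) (m : ι → ℝ) : Prop :=
  ∀ i, IntervalIntegrable (fun t => F t i) MeasureTheory.volume 0 1 ∧
    ∫ t in (0:ℝ)..1, F t i = m i

namespace HasAverage

variable {ι κ : Type*} {F G : ℝ → ι → ℝ} {m g : ι → ℝ}

theorem const (v : ι → ℝ) : HasAverage (fun _ => v) v := fun i =>
  ⟨intervalIntegrable_const, by simp⟩

theorem add (hF : HasAverage F m) (hG : HasAverage G g) :
    HasAverage (fun t => F t + G t) (m + g) := fun i =>
  ⟨(hF i).1.add (hG i).1, by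
    simp only [Pi.add_apply]
    rw [intervalIntegral.integral_add (hF i).1 (hG i).1, (hF i).2, (hG i).2]⟩

theorem sumElim {H : ℝ → κ → ℝ} {h : κ → ℝ} (hF : HasAverage F m) (hH : HasAverage H h) :
    HasAverage (fun t => Sum.elim (F t) (H t)) (Sum.elim m h)
  | .inl i => hF i
  | .inr i => hH i

theorem mulVec [Fintype ι] (hF : HasAverage F m) (M : Matrix κ ι ℝ) :
    HasAverage (fun t => M *ᵥ F t) (M *ᵥ m) := fun i =>
  ⟨by
    simp only [Matrix.mulVec, dotProduct]
    simpa only [Finset.sum_fn] using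
      IntervalIntegrable.sum Finset.univ fun j _ => (hF j).1.const_mul (M i j), by
    simp only [Matrix.mulVec, dotProduct]
    rw [intervalIntegral.integral_finsetSum fun j _ => (hF j).1.const_mul _]
    simp only [intervalIntegral.integral_const_mul, (hF _).2]⟩

theorem matrix_mulVec [Fintype ι] {M : ℝ → Matrix κ ι ℝ} (hM : ContinuousOn M (Icc 0 1))
    (v : ι → ℝ) :
    HasAverage (fun t => M t *ᵥ v) ((Matrix.of fun i j => ∫ t in (0:ℝ)..1, M t i j) *ᵥ v) := by
  have hint : ∀ i j, IntervalIntegrable (fun t => M t i j) MeasureTheory.volume 0 1 := by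
    intro i j
    apply ContinuousOn.intervalIntegrable
    rw [uIcc_of_le zero_le_one]
    exact ((continuous_id.matrix_elem i j).comp_continuousOn hM :)
  refine fun i => ⟨?_, ?_⟩
  · simp only [Matrix.mulVec, dotProduct]
    simpa only [Finset.sum_fn] using
      IntervalIntegrable.sum Finset.univ fun j _ => (hint i j).mul_const (v j)
  · simp only [Matrix.mulVec, dotProduct, Matrix.of_apply]
    rw [intervalIntegral.integral_finsetSum fun j _ => (hint i j).mul_const _]
    simp only [intervalIntegral.integral_mul_const]

theorem intervalIntegrable_dotProduct [Fintype ι] (hF : HasAverage F m) (v : ι → ℝ) :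
    IntervalIntegrable (fun t => F t ⬝ᵥ v) MeasureTheory.volume 0 1 := by
  simpa only [Finset.sum_fn, dotProduct] using
    IntervalIntegrable.sum Finset.univ fun i _ => (hF i).1.mul_const (v i)

theorem integral_dotProduct [Fintype ι] (hF : HasAverage F m) (v : ι → ℝ) :
    ∫ t in (0:ℝ)..1, F t ⬝ᵥ v = m ⬝ᵥ v := by
  simp only [dotProduct]
  rw [intervalIntegral.integral_finsetSum fun i _ => (hF i).1.mul_const (v i)]
  simp only [intervalIntegral.integral_mul_const, (hF _).2]

/-- The average of the derivative of a `C¹` map along a segment is its increment. -/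
theorem fderiv_segment [Fintype ι] [Fintype κ] {f : (ι → ℝ) → κ → ℝ} (hf : ContDiff ℝ 1 f)
    (a b : ι → ℝ) :
    HasAverage (fun t => fderiv ℝ f (a + t • (b - a)) (b - a)) (f b - f a) := by
  intro i
  have hpath : Continuous fun t : ℝ => a + t • (b - a) := by fun_prop
  have hcont : Continuous fun t : ℝ => fderiv ℝ f (a + t • (b - a)) (b - a) i :=
    (continuous_apply i).comp
      (((hf.continuous_fderiv one_ne_zero).comp hpath).clm_apply continuous_const)
  have hderiv (t : ℝ) : HasDerivAt (fun t : ℝ => f (a + t • (b - a)) i)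
      (fderiv ℝ f (a + t • (b - a)) (b - a) i) t := by
    have hline : HasDerivAt (fun t : ℝ => a + t • (b - a)) (b - a) t := by
      simpa using ((hasDerivAt_id t).smul_const (b - a)).const_add a
    exact hasDerivAt_pi.1
      (((hf.differentiable one_ne_zero) _).hasFDerivAt.comp_hasDerivAt t hline) i
  refine ⟨hcont.intervalIntegrable _ _, ?_⟩
  rw [intervalIntegral.integral_eq_sub_of_hasDerivAt (fun t _ => hderiv t)
    (hcont.intervalIntegrable _ _)]
  simp

end HasAverage

theorem Matrix.PosSemidef.two_mul_dotProduct_mulVec_sub_le {ι : Type*} [Fintype ι]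
    {Q : Matrix ι ι ℝ} (hQ : Q.PosSemidef) (v m : ι → ℝ) :
    2 * (v ⬝ᵥ Q *ᵥ m) - m ⬝ᵥ Q *ᵥ m ≤ v ⬝ᵥ Q *ᵥ v := by
  have hsymm : m ⬝ᵥ Q *ᵥ v = v ⬝ᵥ Q *ᵥ m := by
    have hT : Qᵀ = Q := by simpa [Matrix.IsHermitian] using hQ.isHermitian
    rw [dotProduct_mulVec, ← mulVec_transpose, hT, dotProduct_comm]
  have hnonneg := hQ.dotProduct_mulVec_nonneg (v - m)
  simp only [star_trivial, mulVec_sub, dotProduct_sub, sub_dotProduct] at hnonneg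
  linarith

/-- Jensen's inequality for a sum of positive semidefinite quadratic forms. -/
theorem HasAverage.quadratic_le {ι κ : Type*} [Fintype ι] [Fintype κ]
    {F : ℝ → ι → ℝ} {G : ℝ → κ → ℝ} {m : ι → ℝ} {g : κ → ℝ}
    (hF : HasAverage F m) (hG : HasAverage G g) {Q : Matrix ι ι ℝ} (hQ : Q.PosSemidef)
    {c r : ℝ} (hc : 0 ≤ c)
    (h : ∀ t ∈ Icc (0:ℝ) 1, F t ⬝ᵥ Q *ᵥ F t + c * (G t ⬝ᵥ G t) ≤ r) :
    m ⬝ᵥ Q *ᵥ m + c * (g ⬝ᵥ g) ≤ r := by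
  classical
  have hFi := (hF.intervalIntegrable_dotProduct (Q *ᵥ m)).const_mul 2
  have hGi := ((hG.intervalIntegrable_dotProduct g).const_mul (2 * c))
  have hmono := intervalIntegral.integral_mono_on zero_le_one (hFi.add hGi)
    (intervalIntegrable_const (c := r + m ⬝ᵥ Q *ᵥ m + c * (g ⬝ᵥ g))) (fun t ht => by
      have hFt := hQ.two_mul_dotProduct_mulVec_sub_le (F t) m
      have hGt := (Matrix.PosSemidef.one (n := κ) (R := ℝ)).two_mul_dotProduct_mulVec_sub_le
        (G t) g
      simp only [one_mulVec] at hGt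
      have hcGt := mul_le_mul_of_nonneg_left hGt hc
      have ht' := h t ht
      linarith)
  rw [intervalIntegral.integral_add hFi hGi, intervalIntegral.integral_const_mul,
    intervalIntegral.integral_const_mul, hF.integral_dotProduct, hG.integral_dotProduct] at hmono
  simp only [intervalIntegral.integral_const, sub_zero, one_smul] at hmono
  linarith

theorem mulVec_of_apply_single {ι κ : Type*} [Fintype ι] [DecidableEq ι]
    (L : (ι → ℝ) →L[ℝ] κ → ℝ) (v : ι → ℝ) :
    (Matrix.of fun i j => L (Pi.single j 1) i) *ᵥ v = L v := by
  have hL := LinearMap.toMatrix'_mulVec L.toLinearMap v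
  exact hL

/-- A nonnegative storage function satisfying a dissipation inequality yields an `ℓ₂`-gain bound. -/
theorem summable_and_sqrt_tsum_le_of_dissipation {V a b : ℕ → ℝ} {γ : ℝ} (hγ : 0 < γ)
    (hV : ∀ k, 0 ≤ V k) (ha : ∀ k, 0 ≤ a k) (hb : ∀ k, 0 ≤ b k)
    (hdiss : ∀ k, V (k + 1) + γ⁻¹ * b k ≤ V k + γ * a k) (hs : Summable a) :
    Summable b ∧ √(∑' k, b k) ≤ γ * √(∑' k, a k) + √(γ * V 0) := by
  have htel (n : ℕ) : V n + γ⁻¹ * ∑ k ∈ Finset.range n, b k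
      ≤ V 0 + γ * ∑ k ∈ Finset.range n, a k := by
    induction n with
    | zero => simp
    | succ n ih =>
      rw [Finset.sum_range_succ, Finset.sum_range_succ, mul_add, mul_add]
      linarith [hdiss n]
  have hbound (n : ℕ) : ∑ k ∈ Finset.range n, b k ≤ γ * (V 0 + γ * ∑' k, a k) := by
    have hle : γ⁻¹ * ∑ k ∈ Finset.range n, b k ≤ V 0 + γ * ∑' k, a k := by
      have hsum := mul_le_mul_of_nonneg_left
        (hs.sum_le_tsum (Finset.range n) fun k _ => ha k) hγ.le
      linarith [htel n, hV n]
    rwa [inv_mul_le_iff₀ hγ] at hle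
  refine ⟨summable_of_sum_range_le hb hbound, ?_⟩
  have hS : 0 ≤ ∑' k, a k := tsum_nonneg ha
  have hγV : 0 ≤ γ * V 0 := mul_nonneg hγ.le (hV 0)
  apply Real.sqrt_le_iff.2 ⟨by positivity, (Real.tsum_le_of_sum_range_le hb hbound).trans ?_⟩
  have hcross : 0 ≤ γ * √(∑' k, a k) * √(γ * V 0) := by positivity
  rw [add_sq, mul_pow, Real.sq_sqrt hS, Real.sq_sqrt hγV]
  linarith

/-- **Theorem 4, closed-loop incremental ℓ₂-gain of the realized
controller.**  If the closed-loop differential dynamics (LPV embedding of the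
plant's differential form with the differential controller) satisfy a quadratic
dissipation inequality with storage matrix `Q ≻ 0` and gain `γ`, then the closed
loop of the primal plant with the realized (path-integral) primal controller
satisfies the incremental ℓ₂-gain bound
`‖z − z*‖₂ ≤ γ ‖w − w*‖₂ + sqrt(γ θ₀ᵀ Q θ₀)` with `θ₀ = (x₀ − x₀*, Δx_{c,0})`. -/
theorem closed_loop_incremental_l2_gain_realized_controller
    (nx nρ nw nu nz ny nxc : ℕ)
    (Xset : Set (Fin nx → ℝ)) (hXconv : Convex ℝ Xset)
    (Pset : Set (Fin nρ → ℝ))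
    -- the generalized plant
    (f : (Fin nx → ℝ) → (Fin nx → ℝ)) (hz : (Fin nx → ℝ) → (Fin nz → ℝ))
    (hf : ContDiff ℝ 1 f) (hhz : ContDiff ℝ 1 hz)
    (Bw : Matrix (Fin nx) (Fin nw) ℝ) (Bu : Matrix (Fin nx) (Fin nu) ℝ)
    (Dzw : Matrix (Fin nz) (Fin nw) ℝ) (Dzu : Matrix (Fin nz) (Fin nu) ℝ)
    (Cy : Matrix (Fin ny) (Fin nx) ℝ) (Dyw : Matrix (Fin ny) (Fin nw) ℝ)
    -- LPV embedding of the differential form of the plant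
    (ψ : (Fin nx → ℝ) → (Fin nρ → ℝ))
    (hψcont : ContinuousOn ψ Xset) (hψmaps : ∀ x ∈ Xset, ψ x ∈ Pset)
    (A : (Fin nρ → ℝ) → Matrix (Fin nx) (Fin nx) ℝ)
    (Cz : (Fin nρ → ℝ) → Matrix (Fin nz) (Fin nx) ℝ)
    (hAcont : ContinuousOn A Pset) (hCzcont : ContinuousOn Cz Pset)
    (hembA : ∀ x ∈ Xset,
      A (ψ x) = Matrix.of fun i j => fderiv ℝ f x (Pi.single j 1) i)
    (hembC : ∀ x ∈ Xset,
      Cz (ψ x) = Matrix.of fun i j => fderiv ℝ hz x (Pi.single j 1) i)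
    -- the differential controller
    (Aδc : (Fin nρ → ℝ) → Matrix (Fin nxc) (Fin nxc) ℝ)
    (Bδc : (Fin nρ → ℝ) → Matrix (Fin nxc) (Fin ny) ℝ)
    (Cδc : (Fin nρ → ℝ) → Matrix (Fin nu) (Fin nxc) ℝ)
    (Dδc : (Fin nρ → ℝ) → Matrix (Fin nu) (Fin ny) ℝ)
    (hAccont : ContinuousOn Aδc Pset) (hBccont : ContinuousOn Bδc Pset)
    (hCccont : ContinuousOn Cδc Pset) (hDccont : ContinuousOn Dδc Pset)
    -- closed-loop differential dissipation inequality
    (γ : ℝ) (hγ : 0 < γ)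
    (Q : Matrix (Fin nx ⊕ Fin nxc) (Fin nx ⊕ Fin nxc) ℝ) (hQ : Q.PosDef)
    (hdiss : ∀ ρ ∈ Pset, ∀ δχ : Fin nx ⊕ Fin nxc → ℝ, ∀ δw : Fin nw → ℝ,
      ((Matrix.fromBlocks (A ρ + Bu * Dδc ρ * Cy) (Bu * Cδc ρ)
          (Bδc ρ * Cy) (Aδc ρ)).mulVec δχ +
        (Matrix.fromRows (Bw + Bu * Dδc ρ * Dyw) (Bδc ρ * Dyw)).mulVec δw) ⬝ᵥ
        Q.mulVec
          ((Matrix.fromBlocks (A ρ + Bu * Dδc ρ * Cy) (Bu * Cδc ρ)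
              (Bδc ρ * Cy) (Aδc ρ)).mulVec δχ +
            (Matrix.fromRows (Bw + Bu * Dδc ρ * Dyw) (Bδc ρ * Dyw)).mulVec δw)
        - δχ ⬝ᵥ Q.mulVec δχ ≤
      γ * (δw ⬝ᵥ δw) -
        γ⁻¹ * (((Matrix.fromCols (Cz ρ + Dzu * Dδc ρ * Cy) (Dzu * Cδc ρ)).mulVec δχ +
            (Dzw + Dzu * Dδc ρ * Dyw).mulVec δw) ⬝ᵥ
          ((Matrix.fromCols (Cz ρ + Dzu * Dδc ρ * Cy) (Dzu * Cδc ρ)).mulVec δχ +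
            (Dzw + Dzu * Dδc ρ * Dyw).mulVec δw)))
    -- the steady-state plant trajectory (x*, w*, u*, z*, y*)
    (xs : ℕ → Fin nx → ℝ) (ws : ℕ → Fin nw → ℝ) (us : ℕ → Fin nu → ℝ)
    (zs : ℕ → Fin nz → ℝ) (ys : ℕ → Fin ny → ℝ)
    (hxsX : ∀ k, xs k ∈ Xset)
    (hxsS : ∀ k, xs (k + 1) = f (xs k) + Bw.mulVec (ws k) + Bu.mulVec (us k))
    (hzs : ∀ k, zs k = hz (xs k) + Dzw.mulVec (ws k) + Dzu.mulVec (us k))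
    (hys : ∀ k, ys k = Cy.mulVec (xs k) + Dyw.mulVec (ws k))
    -- the closed-loop trajectory of the plant with the realized primal controller
    (x : ℕ → Fin nx → ℝ) (w : ℕ → Fin nw → ℝ) (u : ℕ → Fin nu → ℝ)
    (z : ℕ → Fin nz → ℝ) (y : ℕ → Fin ny → ℝ)
    (hxX : ∀ k, x k ∈ Xset)
    (hxS : ∀ k, x (k + 1) = f (x k) + Bw.mulVec (w k) + Bu.mulVec (u k))
    (hzk : ∀ k, z k = hz (x k) + Dzw.mulVec (w k) + Dzu.mulVec (u k))
    (hyk : ∀ k, y k = Cy.mulVec (x k) + Dyw.mulVec (w k))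
    -- realized primal controller along ρ̄ₖ(λ) = ψ(x*ₖ + λ(xₖ − x*ₖ)),
    -- with u_{c,k} = y_k, u*_{c,k} = y*_k, y*_{c,k} = u*_k, u_k = y_{c,k}
    (Δxc : ℕ → Fin nxc → ℝ) (yc : ℕ → Fin nu → ℝ)
    (hΔS : ∀ k, Δxc (k + 1) =
      (Matrix.of fun i j =>
        ∫ t in (0:ℝ)..1, Aδc (ψ (xs k + t • (x k - xs k))) i j).mulVec (Δxc k) +
      (Matrix.of fun i j =>
        ∫ t in (0:ℝ)..1, Bδc (ψ (xs k + t • (x k - xs k))) i j).mulVec (y k - ys k))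
    (hyck : ∀ k, yc k = us k +
      (Matrix.of fun i j =>
        ∫ t in (0:ℝ)..1, Cδc (ψ (xs k + t • (x k - xs k))) i j).mulVec (Δxc k) +
      (Matrix.of fun i j =>
        ∫ t in (0:ℝ)..1, Dδc (ψ (xs k + t • (x k - xs k))) i j).mulVec (y k - ys k))
    (hinterconnect : ∀ k, u k = yc k) :
    -- conclusion: incremental ℓ₂-gain bound of the closed loop
    (Summable fun k => (w k - ws k) ⬝ᵥ (w k - ws k)) →
    (Summable fun k => (z k - zs k) ⬝ᵥ (z k - zs k)) ∧
      Real.sqrt (∑' k, (z k - zs k) ⬝ᵥ (z k - zs k)) ≤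
        γ * Real.sqrt (∑' k, (w k - ws k) ⬝ᵥ (w k - ws k)) +
          Real.sqrt (γ * (Sum.elim (x 0 - xs 0) (Δxc 0) ⬝ᵥ
            Q.mulVec (Sum.elim (x 0 - xs 0) (Δxc 0)))) := by
  intro hw
  refine summable_and_sqrt_tsum_le_of_dissipation
    (V := fun k => Sum.elim (x k - xs k) (Δxc k) ⬝ᵥ Q *ᵥ Sum.elim (x k - xs k) (Δxc k)) hγ
    (fun k => by simpa using hQ.posSemidef.dotProduct_mulVec_nonneg _)
    (fun k => Finset.sum_nonneg fun i _ => mul_self_nonneg _)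
    (fun k => Finset.sum_nonneg fun i _ => mul_self_nonneg _) (fun k => ?_) hw
  have hseg : MapsTo (fun t : ℝ => xs k + t • (x k - xs k)) (Icc 0 1) Xset := fun t ht =>
    hXconv.add_smul_sub_mem (hxsX k) (hxX k) ht
  have hρ : ContinuousOn (fun t : ℝ => ψ (xs k + t • (x k - xs k))) (Icc 0 1) :=
    hψcont.comp (by fun_prop) hseg
  have hρP : MapsTo (fun t : ℝ => ψ (xs k + t • (x k - xs k))) (Icc 0 1) Pset := fun t ht =>
    hψmaps _ (hseg ht)
  have hy : y k - ys k = Cy *ᵥ (x k - xs k) + Dyw *ᵥ (w k - ws k) := by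
    rw [hyk, hys, mulVec_sub, mulVec_sub]; abel
  have hu := (HasAverage.matrix_mulVec (hCccont.comp hρ hρP) (Δxc k)).add
    (HasAverage.matrix_mulVec (hDccont.comp hρ hρP) (y k - ys k))
  have hxc := (HasAverage.matrix_mulVec (hAccont.comp hρ hρP) (Δxc k)).add
    (HasAverage.matrix_mulVec (hBccont.comp hρ hρP) (y k - ys k))
  simp only [Function.comp_apply] at hu hxc
  rw [← hΔS] at hxc
  have hdu := hinterconnect k
  rw [hyck, add_assoc, ← sub_eq_iff_eq_add'] at hdu
  rw [← hdu] at hu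
  have hF := (((HasAverage.fderiv_segment hf (xs k) (x k)).add
    (HasAverage.const (Bw *ᵥ (w k - ws k)))).add (hu.mulVec Bu)).sumElim hxc
  have hG := ((HasAverage.fderiv_segment hhz (xs k) (x k)).add
    (HasAverage.const (Dzw *ᵥ (w k - ws k)))).add (hu.mulVec Dzu)
  have hx' : f (x k) - f (xs k) + Bw *ᵥ (w k - ws k) + Bu *ᵥ (u k - us k)
      = x (k + 1) - xs (k + 1) := by
    rw [hxS, hxsS, mulVec_sub, mulVec_sub]; abel
  have hz' : hz (x k) - hz (xs k) + Dzw *ᵥ (w k - ws k) + Dzu *ᵥ (u k - us k)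
      = z k - zs k := by
    rw [hzk, hzs, mulVec_sub, mulVec_sub]; abel
  rw [hx'] at hF
  rw [hz'] at hG
  refine hF.quadratic_le hG hQ.posSemidef (inv_pos.2 hγ).le fun t ht => ?_
  have hd := hdiss _ (hρP ht) (Sum.elim (x k - xs k) (Δxc k)) (w k - ws k)
  simp only [fromBlocks_mulVec, fromRows_mulVec, fromCols_mulVec, Sum.elim_comp_inl,
    Sum.elim_comp_inr, ← Sum.elim_add_add] at hd
  have hA : A (ψ (xs k + t • (x k - xs k))) *ᵥ (x k - xs k)
      = fderiv ℝ f (xs k + t • (x k - xs k)) (x k - xs k) := by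
    rw [hembA _ (hseg ht), mulVec_of_apply_single]
  have hC : Cz (ψ (xs k + t • (x k - xs k))) *ᵥ (x k - xs k)
      = fderiv ℝ hz (xs k + t • (x k - xs k)) (x k - xs k) := by
    rw [hembC _ (hseg ht), mulVec_of_apply_single]
  rw [← hA, ← hC, hy]
  set ρ := ψ (xs k + t • (x k - xs k))
  have hFst : A ρ *ᵥ (x k - xs k) + Bw *ᵥ (w k - ws k) + Bu *ᵥ (Cδc ρ *ᵥ Δxc k
        + Dδc ρ *ᵥ (Cy *ᵥ (x k - xs k) + Dyw *ᵥ (w k - ws k)))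
      = (A ρ + Bu * Dδc ρ * Cy) *ᵥ (x k - xs k) + (Bu * Cδc ρ) *ᵥ Δxc k
        + (Bw + Bu * Dδc ρ * Dyw) *ᵥ (w k - ws k) := by
    simp only [add_mulVec, mulVec_add, ← mulVec_mulVec]; abel
  have hSnd : Aδc ρ *ᵥ Δxc k
        + Bδc ρ *ᵥ (Cy *ᵥ (x k - xs k) + Dyw *ᵥ (w k - ws k))
      = (Bδc ρ * Cy) *ᵥ (x k - xs k) + Aδc ρ *ᵥ Δxc k
        + (Bδc ρ * Dyw) *ᵥ (w k - ws k) := by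
    simp only [mulVec_add, ← mulVec_mulVec]; abel
  have hOut : Cz ρ *ᵥ (x k - xs k) + Dzw *ᵥ (w k - ws k) + Dzu *ᵥ (Cδc ρ *ᵥ Δxc k
        + Dδc ρ *ᵥ (Cy *ᵥ (x k - xs k) + Dyw *ᵥ (w k - ws k)))
      = (Cz ρ + Dzu * Dδc ρ * Cy) *ᵥ (x k - xs k) + (Dzu * Cδc ρ) *ᵥ Δxc k
        + (Dzw + Dzu * Dδc ρ * Dyw) *ᵥ (w k - ws k) := by
    simp only [add_mulVec, mulVec_add, ← mulVec_mulVec]; abel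
  rw [hFst, hSnd, hOut]
  linarith
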